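/- Fix K ≥ 1 and γ ≥ 1. For every δ ∈ ℕ_K(γ) there exist m ∈ ℕ and a finite chain δ = δ^(0) → δ^(1) → … → δ^(m) = γ_K of elementary operations transforming δ into the uniform vector γ_K. In particular, the distance D(δ), defined as the minimum number of elementary operations needed to transform δ into γ_K, is well defined (finite) for every δ ∈ ℕ_K(γ). -/

import Mathlib

/-- `δ' ∈ ℕ_K(γ)` is obtained from `δ` by an elementary operation: there is an
index `t` with `δ_t > γ`, one unit is moved from slot `t` to slot `t+1`
(indices modulo `K`, which is the addition of `Fin K`), all other slots
unchanged. -/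
def ElemOp (K : ℕ) [NeZero K] (γ : ℕ) (d d' : Fin K → ℕ) : Prop :=
  ∃ t : Fin K, γ < d t ∧ d' t = d t - 1 ∧ d' (t + 1) = d (t + 1) + 1 ∧
    ∀ k : Fin K, k ≠ t → k ≠ t + 1 → d' k = d k

open Relation

lemma ElemOp.sum_eq {K : ℕ} [NeZero K] {γ : ℕ} {d d' : Fin K → ℕ} (h : ElemOp K γ d d') :
    ∑ k, d' k = ∑ k, d k := by
  obtain ⟨t, ht, h₁, h₂, h₃⟩ := h
  have hne : t + 1 ≠ t := by
    intro h
    rw [h] at h₂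
    omega
  have key : ∀ k, d' k + (if k = t then 1 else 0) = d k + (if k = t + 1 then 1 else 0) := by
    intro k
    by_cases hk : k = t
    · subst hk
      rw [if_pos rfl, if_neg hne.symm]
      omega
    · by_cases hk' : k = t + 1
      · subst hk'
        simp [hne, h₂]
      · simp [hk, hk', h₃ k hk hk']
  have hsum := Finset.sum_congr (rfl : (Finset.univ : Finset (Fin K)) = _) fun k _ => key k
  simpa [Finset.sum_add_distrib] using hsum

lemma exists_elemOp {K : ℕ} [NeZero K] {γ : ℕ} {d : Fin K → ℕ} {t : Fin K} (ht : γ < d t)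
    (hne : t + 1 ≠ t) :
    ∃ d', ElemOp K γ d d' ∧ d' t = d t - 1 ∧ d' (t + 1) = d (t + 1) + 1 ∧
      ∀ k, k ≠ t → k ≠ t + 1 → d' k = d k := by
  have h : Function.update (Function.update d t (d t - 1)) (t + 1) (d (t + 1) + 1) t = d t - 1 := by
    simp [hne.symm]
  have h' : ∀ k, k ≠ t → k ≠ t + 1 →
      Function.update (Function.update d t (d t - 1)) (t + 1) (d (t + 1) + 1) k = d k := by
    intro k hk hk'
    simp [hk, hk']
  exact ⟨_, ⟨t, ht, h, by simp, h'⟩, h, by simp, h'⟩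

open scoped Fin.CommRing in
/-- A unit above capacity at slot `t` can be pushed forward until it fills a slot below capacity,
which lowers the total deficit. -/
lemma exists_reflTransGen_deficit_lt {K : ℕ} [NeZero K] {γ : ℕ} (n : ℕ) (d : Fin K → ℕ)
    (t : Fin K) (ht : γ < d t) (hn : d (t + n) < γ) :
    ∃ d', ReflTransGen (ElemOp K γ) d d' ∧ ∑ k, (γ - d' k) < ∑ k, (γ - d k) := by
  induction n generalizing d t with
  | zero =>
    simp only [Nat.cast_zero, add_zero] at hn
    omega
  | succ n ih =>
    have hne : t + 1 ≠ t := by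
      intro h
      have h1 : (1 : Fin K) = 0 := by simpa using h
      have h2 : t + ((n + 1 : ℕ) : Fin K) = t := by
        rw [← mul_one ((n + 1 : ℕ) : Fin K), h1, mul_zero, add_zero]
      rw [h2] at hn
      omega
    obtain ⟨d', hop, h₁, h₂, h₃⟩ := exists_elemOp ht hne
    have hle : ∀ k, γ - d' k ≤ γ - d k := by
      intro k
      by_cases hk : k = t
      · subst hk
        omega
      · by_cases hk' : k = t + 1
        · subst hk'
          omega
        · rw [h₃ k hk hk']
    by_cases hlt : d (t + 1) < γ
    · exact ⟨d', .single hop, Finset.sum_lt_sum (fun k _ => hle k)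
        ⟨t + 1, Finset.mem_univ _, by omega⟩⟩
    · have hshift : t + ((n + 1 : ℕ) : Fin K) = t + 1 + n := by
        push_cast
        ring
      rw [hshift] at hn
      have hd' : d' (t + 1 + n) < γ := by
        rwa [h₃]
        · intro h
          rw [h] at hn
          omega
        · intro h
          rw [h] at hn
          omega
      obtain ⟨e, he, hlt'⟩ := ih d' (t + 1) (by omega) hd'
      exact ⟨e, .head hop he, hlt'.trans_le (Finset.sum_le_sum fun k _ => hle k)⟩

lemma reflTransGen_elemOp_sum_eq {K : ℕ} [NeZero K] {γ : ℕ} {d d' : Fin K → ℕ}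
    (h : ReflTransGen (ElemOp K γ) d d') : ∑ k, d' k = ∑ k, d k := by
  induction h with
  | refl => rfl
  | tail _ h ih => exact h.sum_eq.trans ih

open scoped Fin.CommRing in
lemma reflTransGen_elemOp_uniform {K : ℕ} [NeZero K] {γ : ℕ} (d : Fin K → ℕ)
    (hd : ∑ k, d k = γ * K) : ReflTransGen (ElemOp K γ) d fun _ => γ := by
  induction hD : ∑ k, (γ - d k) using Nat.strong_induction_on generalizing d with
  | _ D ih =>
    subst hD
    have hsum : ∑ k, d k = ∑ _k : Fin K, γ := by simp [hd, mul_comm]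
    by_cases hall : d = fun _ => γ
    · rw [hall]
    have hover : ∃ t, γ < d t := by
      by_contra! h
      exact hall (funext fun k =>
        (Finset.sum_eq_sum_iff_of_le fun k _ => h k).1 hsum k (Finset.mem_univ k))
    have hunder : ∃ s, d s < γ := by
      by_contra! h
      exact hall (funext fun k =>
        ((Finset.sum_eq_sum_iff_of_le fun k _ => h k).1 hsum.symm k (Finset.mem_univ k)).symm)
    obtain ⟨t, ht⟩ := hover
    obtain ⟨s, hs⟩ := hunder
    obtain ⟨e, he, hlt⟩ := exists_reflTransGen_deficit_lt (s - t).val d t ht (by simpa using hs)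
    exact he.trans (ih _ hlt e ((reflTransGen_elemOp_sum_eq he).trans hd) rfl)

lemma exists_chain_of_reflTransGen {α : Type*} {r : α → α → Prop} {a b : α}
    (h : ReflTransGen r a b) :
    ∃ (m : ℕ) (c : ℕ → α), c 0 = a ∧ c m = b ∧ ∀ i, i < m → r (c i) (c (i + 1)) := by
  induction h using ReflTransGen.head_induction_on with
  | refl => exact ⟨0, fun _ => b, rfl, rfl, by simp⟩
  | @head x y hxy _ ih =>
    obtain ⟨m, c, h0, hm, hc⟩ := ih
    refine ⟨m + 1, fun i => Nat.casesOn i x c, rfl, hm, ?_⟩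
    rintro (_ | i) hi
    · simpa [h0] using hxy
    · exact hc i (by omega)

/-- Every `δ ∈ ℕ_K(γ)` (entries summing to `γK`) can be transformed into the
uniform vector `γ_K = (γ,…,γ)` by a finite chain of elementary operations;
hence the distance `D(δ)` (the minimum number of elementary operations needed)
is well defined and finite. -/
theorem exists_chain_to_uniform
    (K : ℕ) [NeZero K] (hK : 1 ≤ K) (γ : ℕ) (hγ : 1 ≤ γ)
    (d : Fin K → ℕ) (hd : ∑ k, d k = γ * K) :
    ∃ (m : ℕ) (c : ℕ → Fin K → ℕ),
      c 0 = d ∧ c m = (fun _ => γ) ∧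
      ∀ i, i < m → ElemOp K γ (c i) (c (i + 1)) := by
  exact exists_chain_of_reflTransGen (reflTransGen_elemOp_uniform d hd)
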